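/- Let 0 < E_D < E₀, let K_1, …, K_m ∈ ℝ^{n×n} be symmetric positive semidefinite with K_1 + … + K_m positive definite, let f ∈ ℝ^n and μ > 0. Then the functional Φ_μ(δ, u) = −2 fᵀu + Σ_{e=1}^m h(δ_e) uᵀK_e u − μ Σ_{e=1}^m (log δ_e + log(1−δ_e)), with h(δ) = ((1−δ)/E₀ + δ/E_D)⁻¹, attains a global minimum on (0,1)^m × ℝ^n, and the minimizer is unique. -/

import Mathlib

open Matrix

/-- The harmonic material interpolation between moduli `E₀` and `E_D`. -/
noncomputable def hInterp (E₀ E_D δ : ℝ) : ℝ := ((1 - δ) / E₀ + δ / E_D)⁻¹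

/-- The barrier-augmented inner cost functional `Φ_μ`. -/
noncomputable def innerCost {m n : ℕ} (E₀ E_D : ℝ) (K : Fin m → Matrix (Fin n) (Fin n) ℝ)
    (f : Fin n → ℝ) (μ : ℝ) (p : (Fin m → ℝ) × (Fin n → ℝ)) : ℝ :=
  -2 * (f ⬝ᵥ p.2) + ∑ e, hInterp E₀ E_D (p.1 e) * (p.2 ⬝ᵥ K e *ᵥ p.2)
    - μ * ∑ e, (Real.log (p.1 e) + Real.log (1 - p.1 e))

lemma hInterp_denom_pos {E₀ E_D δ : ℝ} (hED : 0 < E_D) (hE : E_D < E₀)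
    (hδ : δ ∈ Set.Ioo (0 : ℝ) 1) :
    0 < (1 - δ) / E₀ + δ / E_D :=
  add_pos (div_pos (sub_pos.2 hδ.2) (hED.trans hE)) (div_pos hδ.1 hED)

lemma le_hInterp {E₀ E_D δ : ℝ} (hED : 0 < E_D) (hE : E_D < E₀) (hδ : δ ∈ Set.Ioo (0 : ℝ) 1) :
    E_D ≤ hInterp E₀ E_D δ := by
  unfold hInterp
  rw [le_inv_comm₀ hED (hInterp_denom_pos hED hE hδ), ← one_div]
  have h : (1 - δ) / E₀ ≤ (1 - δ) / E_D :=
    div_le_div_of_nonneg_left (sub_nonneg.2 hδ.2.le) hED hE.le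
  calc (1 - δ) / E₀ + δ / E_D ≤ (1 - δ) / E_D + δ / E_D := by gcongr
    _ = 1 / E_D := by ring

lemma midpoint_mem_Ioo {a b : ℝ} (ha : a ∈ Set.Ioo (0 : ℝ) 1) (hb : b ∈ Set.Ioo (0 : ℝ) 1) :
    (a + b) / 2 ∈ Set.Ioo (0 : ℝ) 1 :=
  ⟨by linarith [ha.1, hb.1], by linarith [ha.2, hb.2]⟩

lemma log_midpoint_lt {a b : ℝ} (ha : 0 < a) (hb : 0 < b) (hab : a ≠ b) :
    (Real.log a + Real.log b) / 2 < Real.log ((a + b) / 2) := by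
  have h := strictConcaveOn_log_Ioi.2 (Set.mem_Ioi.2 ha) (Set.mem_Ioi.2 hb) hab
    one_half_pos one_half_pos (add_halves 1)
  simp only [smul_eq_mul] at h
  rw [show 1 / 2 * a + 1 / 2 * b = (a + b) / 2 by ring] at h
  linarith

lemma barrier_midpoint_lt {a b : ℝ} (ha : a ∈ Set.Ioo (0 : ℝ) 1) (hb : b ∈ Set.Ioo (0 : ℝ) 1)
    (hab : a ≠ b) :
    (Real.log a + Real.log (1 - a) + (Real.log b + Real.log (1 - b))) / 2 <
      Real.log ((a + b) / 2) + Real.log (1 - (a + b) / 2) := by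
  have h₁ := log_midpoint_lt ha.1 hb.1 hab
  have h₂ := log_midpoint_lt (sub_pos.2 ha.2) (sub_pos.2 hb.2) (fun h => hab (sub_right_inj.1 h))
  rw [show (1 - a + (1 - b)) / 2 = 1 - (a + b) / 2 by ring] at h₂
  linarith

lemma barrier_midpoint_le {a b : ℝ} (ha : a ∈ Set.Ioo (0 : ℝ) 1) (hb : b ∈ Set.Ioo (0 : ℝ) 1) :
    (Real.log a + Real.log (1 - a) + (Real.log b + Real.log (1 - b))) / 2 ≤
      Real.log ((a + b) / 2) + Real.log (1 - (a + b) / 2) := by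
  rcases eq_or_ne a b with rfl | hab
  · rw [add_self_div_two, add_self_div_two]
  · exact (barrier_midpoint_lt ha hb hab).le

section QuadraticForm

variable {n : ℕ} {A : Matrix (Fin n) (Fin n) ℝ}

lemma Matrix.PosSemidef.quadratic_nonneg (hA : A.PosSemidef) (u : Fin n → ℝ) :
    0 ≤ u ⬝ᵥ A *ᵥ u := by
  simpa using hA.dotProduct_mulVec_nonneg u

lemma Matrix.PosDef.quadratic_pos (hA : A.PosDef) {u : Fin n → ℝ} (hu : u ≠ 0) :
    0 < u ⬝ᵥ A *ᵥ u := by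
  simpa using hA.dotProduct_mulVec_pos hu

lemma quadratic_smul_add_smul (A : Matrix (Fin n) (Fin n) ℝ) (s t : ℝ) (u v : Fin n → ℝ) :
    (s • u + t • v) ⬝ᵥ A *ᵥ (s • u + t • v) =
      s ^ 2 * (u ⬝ᵥ A *ᵥ u) + s * t * (u ⬝ᵥ A *ᵥ v + v ⬝ᵥ A *ᵥ u) + t ^ 2 * (v ⬝ᵥ A *ᵥ v) := by
  simp only [mulVec_add, mulVec_smul, add_dotProduct, dotProduct_add, smul_dotProduct,
    dotProduct_smul, smul_eq_mul]
  ring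

lemma quadratic_sum {m : ℕ} (K : Fin m → Matrix (Fin n) (Fin n) ℝ) (u : Fin n → ℝ) :
    u ⬝ᵥ (∑ e, K e) *ᵥ u = ∑ e, u ⬝ᵥ K e *ᵥ u := by
  rw [sum_mulVec, dotProduct_sum]

/-- Joint midpoint convexity of the quadratic-over-linear function. -/
lemma Matrix.PosSemidef.quadratic_over_linear_midpoint_le (hA : A.PosSemidef) {a b : ℝ}
    (ha : 0 < a) (hb : 0 < b) (u v : Fin n → ℝ) :
    ((a + b) / 2)⁻¹ * (((1 / 2 : ℝ) • u + (1 / 2 : ℝ) • v) ⬝ᵥ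
        A *ᵥ ((1 / 2 : ℝ) • u + (1 / 2 : ℝ) • v)) ≤
      (a⁻¹ * (u ⬝ᵥ A *ᵥ u) + b⁻¹ * (v ⬝ᵥ A *ᵥ v)) / 2 := by
  have h := hA.quadratic_nonneg (b • u + (-a) • v)
  rw [quadratic_smul_add_smul] at h ⊢
  generalize u ⬝ᵥ A *ᵥ u = X at *
  generalize v ⬝ᵥ A *ᵥ v = Y at *
  generalize u ⬝ᵥ A *ᵥ v + v ⬝ᵥ A *ᵥ u = Z at *
  have key : (a⁻¹ * X + b⁻¹ * Y) / 2 - ((a + b) / 2)⁻¹ *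
      ((1 / 2) ^ 2 * X + 1 / 2 * (1 / 2) * Z + (1 / 2) ^ 2 * Y) =
      (b ^ 2 * X + b * -a * Z + (-a) ^ 2 * Y) / (2 * a * b * (a + b)) := by
    have : a + b ≠ 0 := (add_pos ha hb).ne'
    field_simp
    ring
  have : 0 ≤ (b ^ 2 * X + b * -a * Z + (-a) ^ 2 * Y) / (2 * a * b * (a + b)) := by positivity
  linarith

lemma continuous_quadratic (A : Matrix (Fin n) (Fin n) ℝ) :
    Continuous fun u : Fin n → ℝ => u ⬝ᵥ A *ᵥ u := by
  fun_prop

lemma Matrix.PosDef.exists_mul_norm_sq_le (hA : A.PosDef) :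
    ∃ c > 0, ∀ u : Fin n → ℝ, c * ‖u‖ ^ 2 ≤ u ⬝ᵥ A *ᵥ u := by
  rcases (Metric.sphere (0 : Fin n → ℝ) 1).eq_empty_or_nonempty with hS | hS
  · refine ⟨1, one_pos, fun u => ?_⟩
    rcases eq_or_ne u 0 with rfl | hu
    · simp
    · have : ‖u‖⁻¹ • u ∈ Metric.sphere (0 : Fin n → ℝ) 1 := by
        simp [norm_smul, hu]
      simp [hS] at this
  · obtain ⟨w, hw, hmin⟩ := (isCompact_sphere (0 : Fin n → ℝ) 1).exists_isMinOn hS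
      (continuous_quadratic A).continuousOn
    have hw0 : w ≠ 0 := ne_zero_of_mem_unit_sphere ⟨w, hw⟩
    refine ⟨_, hA.quadratic_pos hw0, fun u => ?_⟩
    rcases eq_or_ne u 0 with rfl | hu
    · simp
    · have hmem : ‖u‖⁻¹ • u ∈ Metric.sphere (0 : Fin n → ℝ) 1 := by
        simp [norm_smul, hu]
      have h := isMinOn_iff.1 hmin _ hmem
      simp only [mulVec_smul, dotProduct_smul, smul_dotProduct, smul_eq_mul] at h
      have hu' : 0 < ‖u‖ := norm_pos_iff.2 hu
      rw [← mul_assoc, ← mul_inv, ← div_eq_inv_mul, le_div_iff₀ (by positivity), ← sq] at h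
      exact h

lemma abs_dotProduct_le (f u : Fin n → ℝ) : |f ⬝ᵥ u| ≤ (∑ i, |f i|) * ‖u‖ := by
  rw [dotProduct, Finset.sum_mul]
  refine (Finset.abs_sum_le_sum_abs _ _).trans (Finset.sum_le_sum fun i _ => ?_)
  rw [abs_mul]
  exact mul_le_mul_of_nonneg_left (norm_le_pi_norm u i) (abs_nonneg _)

end QuadraticForm

section InnerCost

variable {m n : ℕ} {E₀ E_D : ℝ} {K : Fin m → Matrix (Fin n) (Fin n) ℝ}

lemma mul_quadratic_sum_le (hED : 0 < E_D) (hE : E_D < E₀) (hK : ∀ e, (K e).PosSemidef)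
    {δ : Fin m → ℝ} (hδ : ∀ e, δ e ∈ Set.Ioo (0 : ℝ) 1) (u : Fin n → ℝ) :
    E_D * (u ⬝ᵥ (∑ e, K e) *ᵥ u) ≤ ∑ e, hInterp E₀ E_D (δ e) * (u ⬝ᵥ K e *ᵥ u) := by
  rw [quadratic_sum, Finset.mul_sum]
  exact Finset.sum_le_sum fun e _ =>
    mul_le_mul_of_nonneg_right (le_hInterp hED hE (hδ e)) ((hK e).quadratic_nonneg u)

lemma hInterp_quadratic_midpoint_le {A : Matrix (Fin n) (Fin n) ℝ} (hED : 0 < E_D) (hE : E_D < E₀)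
    (hA : A.PosSemidef) {a b : ℝ} (ha : a ∈ Set.Ioo (0 : ℝ) 1) (hb : b ∈ Set.Ioo (0 : ℝ) 1)
    (u v : Fin n → ℝ) :
    hInterp E₀ E_D ((a + b) / 2) * (((1 / 2 : ℝ) • u + (1 / 2 : ℝ) • v) ⬝ᵥ
        A *ᵥ ((1 / 2 : ℝ) • u + (1 / 2 : ℝ) • v)) ≤
      (hInterp E₀ E_D a * (u ⬝ᵥ A *ᵥ u) + hInterp E₀ E_D b * (v ⬝ᵥ A *ᵥ v)) / 2 := by
  have h := hA.quadratic_over_linear_midpoint_le (hInterp_denom_pos hED hE ha)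
    (hInterp_denom_pos hED hE hb) u v
  unfold hInterp
  rwa [show (1 - (a + b) / 2) / E₀ + (a + b) / 2 / E_D =
    ((1 - a) / E₀ + a / E_D + ((1 - b) / E₀ + b / E_D)) / 2 by ring]

/-- Strict midpoint convexity of the inner cost. -/
lemma innerCost_midpoint_lt (hED : 0 < E_D) (hE : E_D < E₀) (hK : ∀ e, (K e).PosSemidef)
    (hKsum : (∑ e, K e).PosDef) (f : Fin n → ℝ) {μ : ℝ} (hμ : 0 < μ)
    {p q : (Fin m → ℝ) × (Fin n → ℝ)} (hp : ∀ e, p.1 e ∈ Set.Ioo (0 : ℝ) 1)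
    (hq : ∀ e, q.1 e ∈ Set.Ioo (0 : ℝ) 1) (hpq : p ≠ q) :
    innerCost E₀ E_D K f μ
        (fun e => (p.1 e + q.1 e) / 2, (1 / 2 : ℝ) • p.2 + (1 / 2 : ℝ) • q.2) <
      (innerCost E₀ E_D K f μ p + innerCost E₀ E_D K f μ q) / 2 := by
  obtain ⟨a, u⟩ := p
  obtain ⟨b, v⟩ := q
  simp only at hp hq
  simp only [innerCost]
  have hlin : f ⬝ᵥ ((1 / 2 : ℝ) • u + (1 / 2 : ℝ) • v) = (f ⬝ᵥ u + f ⬝ᵥ v) / 2 := by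
    simp only [dotProduct_add, dotProduct_smul, smul_eq_mul]
    ring
  have hquad := Finset.sum_le_sum fun e (_ : e ∈ Finset.univ) =>
    hInterp_quadratic_midpoint_le hED hE (hK e) (hp e) (hq e) u v
  have hbar := Finset.sum_le_sum fun e (_ : e ∈ Finset.univ) => barrier_midpoint_le (hp e) (hq e)
  rw [← Finset.sum_div, Finset.sum_add_distrib] at hquad hbar
  by_cases hab : a = b
  · subst hab
    have huv : u - v ≠ 0 := sub_ne_zero.2 fun h => hpq (by rw [h])
    have hpos : 0 < ∑ e, hInterp E₀ E_D (a e) * ((u - v) ⬝ᵥ K e *ᵥ (u - v)) :=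
      (mul_pos hED (hKsum.quadratic_pos huv)).trans_le (mul_quadratic_sum_le hED hE hK hp _)
    have hpar : ∑ e, hInterp E₀ E_D ((a e + a e) / 2) *
          (((1 / 2 : ℝ) • u + (1 / 2 : ℝ) • v) ⬝ᵥ K e *ᵥ ((1 / 2 : ℝ) • u + (1 / 2 : ℝ) • v)) =
        (∑ e, hInterp E₀ E_D (a e) * (u ⬝ᵥ K e *ᵥ u) +
          ∑ e, hInterp E₀ E_D (a e) * (v ⬝ᵥ K e *ᵥ v)) / 2 -
        (∑ e, hInterp E₀ E_D (a e) * ((u - v) ⬝ᵥ K e *ᵥ (u - v))) / 4 := by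
      rw [← Finset.sum_add_distrib, Finset.sum_div, Finset.sum_div, ← Finset.sum_sub_distrib]
      refine Finset.sum_congr rfl fun e _ => ?_
      have huv' : u - v = (1 : ℝ) • u + (-1 : ℝ) • v := by
        rw [one_smul, neg_one_smul, sub_eq_add_neg]
      rw [add_self_div_two, huv', quadratic_smul_add_smul, quadratic_smul_add_smul]
      ring
    rw [hlin, hpar]
    nlinarith [mul_le_mul_of_nonneg_left hbar hμ.le]
  · obtain ⟨e₀, he₀⟩ := Function.ne_iff.1 hab
    have hbar' := Finset.sum_lt_sum
      (fun e (_ : e ∈ Finset.univ) => barrier_midpoint_le (hp e) (hq e))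
      ⟨e₀, Finset.mem_univ _, barrier_midpoint_lt (hp e₀) (hq e₀) he₀⟩
    rw [← Finset.sum_div, Finset.sum_add_distrib] at hbar'
    rw [hlin]
    nlinarith [mul_lt_mul_of_pos_left hbar' hμ]

lemma log_add_log_one_sub_nonpos {δ : ℝ} (hδ : δ ∈ Set.Ioo (0 : ℝ) 1) :
    Real.log δ + Real.log (1 - δ) ≤ 0 :=
  add_nonpos (Real.log_nonpos hδ.1.le hδ.2.le)
    (Real.log_nonpos (sub_nonneg.2 hδ.2.le) (by linarith [hδ.1]))

lemma mem_Icc_of_le_log_add_log {δ c : ℝ} (hδ : δ ∈ Set.Ioo (0 : ℝ) 1)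
    (h : c ≤ Real.log δ + Real.log (1 - δ)) : δ ∈ Set.Icc (Real.exp c) (1 - Real.exp c) := by
  have h₁ := Real.log_nonpos hδ.1.le hδ.2.le
  have h₂ := Real.log_nonpos (sub_nonneg.2 hδ.2.le) (by linarith [hδ.1] : 1 - δ ≤ 1)
  have h₃ := (Real.le_log_iff_exp_le hδ.1).1 (by linarith : c ≤ Real.log δ)
  have h₄ := (Real.le_log_iff_exp_le (sub_pos.2 hδ.2)).1 (by linarith : c ≤ Real.log (1 - δ))
  exact ⟨h₃, by linarith⟩

/-- Sublevel sets of the inner cost stay in a box bounded away from the barrier. -/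
lemma exists_box_of_innerCost_le (hED : 0 < E_D) (hE : E_D < E₀) (hK : ∀ e, (K e).PosSemidef)
    (hKsum : (∑ e, K e).PosDef) (f : Fin n → ℝ) {μ : ℝ} (hμ : 0 < μ) (C : ℝ) :
    ∃ ε > 0, ∃ R : ℝ, ∀ p : (Fin m → ℝ) × (Fin n → ℝ), (∀ e, p.1 e ∈ Set.Ioo (0 : ℝ) 1) →
      innerCost E₀ E_D K f μ p ≤ C →
      p ∈ (Set.univ.pi fun _ => Set.Icc ε (1 - ε)) ×ˢ Metric.closedBall (0 : Fin n → ℝ) R := by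
  obtain ⟨c, hc, hcu⟩ := hKsum.exists_mul_norm_sq_le
  set F := ∑ i, |f i|
  have hF0 : 0 ≤ F := Finset.sum_nonneg fun i _ => abs_nonneg _
  set k := E_D * c with hk
  have hk0 : 0 < k := mul_pos hED hc
  set R := (2 * F + |C|) / k + 1 with hR
  have hR1 : 1 ≤ R := by
    have : 0 ≤ (2 * F + |C|) / k := by positivity
    linarith
  have hkR : k * R = 2 * F + |C| + k := by
    rw [hR]; field_simp
  refine ⟨Real.exp (-((C + 2 * F * R) / μ)), Real.exp_pos _, R, fun p hp hpC => ?_⟩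
  obtain ⟨δ, u⟩ := p
  simp only at hp
  simp only [innerCost] at hpC
  have hlin : f ⬝ᵥ u ≤ F * ‖u‖ := (le_abs_self _).trans (abs_dotProduct_le f u)
  have hquad : k * ‖u‖ ^ 2 ≤ ∑ e, hInterp E₀ E_D (δ e) * (u ⬝ᵥ K e *ᵥ u) := by
    refine le_trans ?_ (mul_quadratic_sum_le hED hE hK hp u)
    rw [hk, mul_assoc]
    exact mul_le_mul_of_nonneg_left (hcu u) hED.le
  have hbar (e : Fin m) : ∑ e, (Real.log (δ e) + Real.log (1 - δ e)) ≤
      Real.log (δ e) + Real.log (1 - δ e) := by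
    rw [← Finset.add_sum_erase _ _ (Finset.mem_univ e)]
    exact add_le_of_nonpos_right
      (Finset.sum_nonpos fun e _ => log_add_log_one_sub_nonpos (hp e))
  have hbar0 : μ * ∑ e, (Real.log (δ e) + Real.log (1 - δ e)) ≤ 0 :=
    mul_nonpos_of_nonneg_of_nonpos hμ.le
      (Finset.sum_nonpos fun e _ => log_add_log_one_sub_nonpos (hp e))
  have hu : ‖u‖ ≤ R := by
    by_contra! hlt
    have h₁ : k * R * ‖u‖ ≤ k * ‖u‖ ^ 2 := by
      rw [sq, ← mul_assoc]
      gcongr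
    rw [hkR] at h₁
    have h₂ : |C| ≤ |C| * ‖u‖ := le_mul_of_one_le_right (abs_nonneg C) (hR1.trans hlt.le)
    have h₃ : 0 < k * ‖u‖ := mul_pos hk0 (by linarith)
    linarith [le_abs_self C]
  refine ⟨fun e _ => mem_Icc_of_le_log_add_log (hp e) ?_, mem_closedBall_zero_iff.2 hu⟩
  have h₁ : F * ‖u‖ ≤ F * R := by gcongr
  have h₂ : 0 ≤ k * ‖u‖ ^ 2 := by positivity
  rw [← neg_div, div_le_iff₀ hμ]
  linarith [mul_le_mul_of_nonneg_left (hbar e) hμ.le]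

lemma continuousOn_innerCost (hED : 0 < E_D) (hE : E_D < E₀)
    (K : Fin m → Matrix (Fin n) (Fin n) ℝ) (f : Fin n → ℝ) (μ : ℝ) :
    ContinuousOn (innerCost E₀ E_D K f μ) {p | ∀ e, p.1 e ∈ Set.Ioo (0 : ℝ) 1} := by
  have hδ (e : Fin m) : Continuous fun p : (Fin m → ℝ) × (Fin n → ℝ) => p.1 e := by fun_prop
  have hlog₁ (e : Fin m) : ContinuousOn
      (fun p : (Fin m → ℝ) × (Fin n → ℝ) => Real.log (p.1 e))
      {p | ∀ e, p.1 e ∈ Set.Ioo (0 : ℝ) 1} :=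
    (hδ e).continuousOn.log fun p hp => (hp e).1.ne'
  have hlog₂ (e : Fin m) : ContinuousOn
      (fun p : (Fin m → ℝ) × (Fin n → ℝ) => Real.log (1 - p.1 e))
      {p | ∀ e, p.1 e ∈ Set.Ioo (0 : ℝ) 1} :=
    (continuous_const.sub (hδ e)).continuousOn.log fun p hp => (sub_pos.2 (hp e).2).ne'
  have hint (e : Fin m) : ContinuousOn
      (fun p : (Fin m → ℝ) × (Fin n → ℝ) => hInterp E₀ E_D (p.1 e))
      {p | ∀ e, p.1 e ∈ Set.Ioo (0 : ℝ) 1} :=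
    ContinuousOn.inv₀ (Continuous.continuousOn (by fun_prop))
      fun p hp => (hInterp_denom_pos hED hE (hp e)).ne'
  have hquad (e : Fin m) : Continuous
      fun p : (Fin m → ℝ) × (Fin n → ℝ) => p.2 ⬝ᵥ K e *ᵥ p.2 :=
    (continuous_quadratic (K e)).comp continuous_snd
  have hlin : Continuous fun p : (Fin m → ℝ) × (Fin n → ℝ) => -2 * (f ⬝ᵥ p.2) := by fun_prop
  exact (hlin.continuousOn.add
    (continuousOn_finsetSum _ fun e _ => (hint e).mul (hquad e).continuousOn)).sub
    (continuousOn_const.mul (continuousOn_finsetSum _ fun e _ => (hlog₁ e).add (hlog₂ e)))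

lemma exists_innerCost_minimizer (hED : 0 < E_D) (hE : E_D < E₀) (hK : ∀ e, (K e).PosSemidef)
    (hKsum : (∑ e, K e).PosDef) (f : Fin n → ℝ) {μ : ℝ} (hμ : 0 < μ) :
    ∃ p : (Fin m → ℝ) × (Fin n → ℝ), (∀ e, p.1 e ∈ Set.Ioo (0 : ℝ) 1) ∧
      ∀ q : (Fin m → ℝ) × (Fin n → ℝ), (∀ e, q.1 e ∈ Set.Ioo (0 : ℝ) 1) →
        innerCost E₀ E_D K f μ p ≤ innerCost E₀ E_D K f μ q := by
  let p₀ : (Fin m → ℝ) × (Fin n → ℝ) := (fun _ => 1 / 2, 0)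
  have hp₀ : ∀ e, p₀.1 e ∈ Set.Ioo (0 : ℝ) 1 := fun e => by norm_num [p₀]
  obtain ⟨ε, hε, R, hbox⟩ :=
    exists_box_of_innerCost_le hED hE hK hKsum f hμ (innerCost E₀ E_D K f μ p₀)
  have hsub : (Set.univ.pi fun _ : Fin m => Set.Icc ε (1 - ε)) ×ˢ
      Metric.closedBall (0 : Fin n → ℝ) R ⊆ {p | ∀ e, p.1 e ∈ Set.Ioo (0 : ℝ) 1} :=
    fun p hp e => ⟨hε.trans_le (hp.1 e trivial).1, (hp.1 e trivial).2.trans_lt (by linarith)⟩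
  obtain ⟨p, hp, hmin⟩ := ((isCompact_univ_pi fun _ => isCompact_Icc).prod
    (isCompact_closedBall 0 R)).exists_isMinOn ⟨p₀, hbox p₀ hp₀ le_rfl⟩
    ((continuousOn_innerCost hED hE K f μ).mono hsub)
  refine ⟨p, hsub hp, fun q hq => ?_⟩
  rcases le_total (innerCost E₀ E_D K f μ q) (innerCost E₀ E_D K f μ p₀) with h | h
  · exact isMinOn_iff.1 hmin q (hbox q hq h)
  · exact (isMinOn_iff.1 hmin p₀ (hbox p₀ hp₀ le_rfl)).trans h

end InnerCost

/-- The barrier-augmented inner cost functional `Φ_μ` attains a global minimum on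
`(0,1)^m × ℝⁿ`, and the minimizer is unique. -/
theorem stmt_7 (m n : ℕ) (E₀ E_D : ℝ) (hED : 0 < E_D) (hE : E_D < E₀)
    (K : Fin m → Matrix (Fin n) (Fin n) ℝ) (hK : ∀ e, (K e).PosSemidef)
    (hKsum : (∑ e, K e).PosDef) (f : Fin n → ℝ) (μ : ℝ) (hμ : 0 < μ) :
    ∃! p : (Fin m → ℝ) × (Fin n → ℝ),
      (∀ e, p.1 e ∈ Set.Ioo (0 : ℝ) 1) ∧
      ∀ q : (Fin m → ℝ) × (Fin n → ℝ), (∀ e, q.1 e ∈ Set.Ioo (0 : ℝ) 1) →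
        (-2 * (f ⬝ᵥ p.2) + ∑ e, hInterp E₀ E_D (p.1 e) * (p.2 ⬝ᵥ K e *ᵥ p.2)
            - μ * ∑ e, (Real.log (p.1 e) + Real.log (1 - p.1 e))) ≤
        (-2 * (f ⬝ᵥ q.2) + ∑ e, hInterp E₀ E_D (q.1 e) * (q.2 ⬝ᵥ K e *ᵥ q.2)
            - μ * ∑ e, (Real.log (q.1 e) + Real.log (1 - q.1 e))) := by
  obtain ⟨p, hp, hmin⟩ := exists_innerCost_minimizer hED hE hK hKsum f hμ
  refine ⟨p, ⟨hp, hmin⟩, fun q ⟨hq, hqmin⟩ => ?_⟩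
  by_contra hne
  have hlt := innerCost_midpoint_lt hED hE hK hKsum f hμ hq hp hne
  have hqp : innerCost E₀ E_D K f μ q ≤ innerCost E₀ E_D K f μ p := hqmin p hp
  have hpmid := hmin (fun e => (q.1 e + p.1 e) / 2, (1 / 2 : ℝ) • q.2 + (1 / 2 : ℝ) • p.2)
    fun e => midpoint_mem_Ioo (hq e) (hp e)
  linarith
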